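/- Pattern matching in the lambda calculus: given non-overlapping sequences of patterns α_1,…,α_n, each of length m, there exist a lambda term PAT^m_{α_1,…,α_n} and an integer l such that for all values V_1,…,V_n: (a) if constructor terms matching α_i are supplied (instantiating the pattern variables with constructor terms t^j_k), then PAT applied to their Scott encodings and V_1,…,V_n reduces in at most l weak CBV steps to V_i applied to the encodings of the instantiating terms; (b) if the m encoded arguments match none of α_1,…,α_n, or one of them is ⊥, then the application reduces in at most l steps to ⊥. -/

import Mathlib

/-- Pure untyped λ-terms with named variables. -/
inductive Tm : Type
  | var : ℕ → Tm
  | lam : ℕ → Tm → Tm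
  | app : Tm → Tm → Tm
deriving DecidableEq

namespace Tm

/-- Free variables. -/
def fv : Tm → Finset ℕ
  | var x => {x}
  | lam x M => fv M \ {x}
  | app M N => fv M ∪ fv N

/-- A term is closed when it has no free variables. -/
def Closed (M : Tm) : Prop := fv M = ∅

/-- Values: variables and abstractions. -/
def IsValue : Tm → Prop
  | var _ => True
  | lam _ _ => True
  | app _ _ => False

/-- (Naive) substitution `M{N/x}`. -/
def subst : Tm → ℕ → Tm → Tm
  | var y, x, N => if y = x then N else var y
  | lam y P, x, N => if y = x then lam y P else lam y (subst P x N)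
  | app P Q, x, N => app (subst P x N) (subst Q x N)

/-- Weak call-by-value reduction: β-redexes whose argument is a value,
closed under both application contexts, never under λ. -/
inductive Cbv : Tm → Tm → Prop
  | beta {x M V} : IsValue V → Cbv (app (lam x M) V) (subst M x V)
  | appL {M N L} : Cbv M N → Cbv (app M L) (app N L)
  | appR {M N L} : Cbv M N → Cbv (app L M) (app L N)

/-- The subterm relation on λ-terms. -/
inductive Sub : Tm → Tm → Prop
  | refl (M) : Sub M M
  | lam {M N x} : Sub M N → Sub M (lam x N)
  | appL {M N L} : Sub M N → Sub M (app N L)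
  | appR {M N L} : Sub M L → Sub M (app N L)

end Tm

/-- `M N₁ … Nₖ` (left-nested application). -/
def appList : Tm → List Tm → Tm := List.foldl Tm.app

/-- `λx₁.…λxₖ.M`. -/
def lams : List ℕ → Tm → Tm := fun xs M => xs.foldr Tm.lam M

/-- `stepsN R n a b`: `a` reduces to `b` in exactly `n` `R`-steps. -/
def stepsN {α : Type*} (R : α → α → Prop) : ℕ → α → α → Prop
  | 0, a, b => a = b
  | n + 1, a, b => ∃ c, R a c ∧ stepsN R n c b

/-- `a` is an `R`-normal form. -/
def NormalForm {α : Type*} (R : α → α → Prop) (a : α) : Prop := ¬ ∃ b, R a b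

/-- First-order constructor terms over a signature with constructors
`c_0,…,c_{g-1}` (indices as naturals). -/
inductive CTm : Type
  | mk : ℕ → List CTm → CTm

/-- Well-formed constructor terms over the signature with `g` constructors of
arities `ar`. -/
inductive CTm.WFC (g : ℕ) (ar : Fin g → ℕ) : CTm → Prop
  | mk {i : ℕ} {ts : List CTm} (h : i < g) :
      ts.length = ar ⟨i, h⟩ → (∀ t ∈ ts, CTm.WFC g ar t) →
      CTm.WFC g ar (CTm.mk i ts)

/-- Scott encoding of constructor terms:
`⌈cᵢ(t₁,…,tₙ)⌉ = λx₁…λx_g.λy. xᵢ ⌈t₁⌉…⌈tₙ⌉`. -/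
def CTm.encode (g : ℕ) : CTm → Tm
  | .mk i ts =>
      lams (List.range (g + 1))
        (appList (.var i) (ts.attach.map fun t => CTm.encode g t.1))
termination_by t => sizeOf t
decreasing_by all_goals first
  | (simp_wf; have := List.sizeOf_lt_of_mem t.2; omega)
  | (simp_wf; omega)
  | simp_wf

/-- The error value `⊥ = λx₁…λx_g.λy.y`. -/
def errTm (g : ℕ) : Tm := lams (List.range (g + 1)) (.var g)

/-- The λ-term `⌈cᵢ⌉ = λx₁…λx_{ar i}.λy₁…λy_g.λz. yᵢ x₁ … x_{ar i}`
computing the constructor `cᵢ`. -/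
def encC (g : ℕ) (ar : Fin g → ℕ) (i : Fin g) : Tm :=
  lams (List.range' (g + 1) (ar i) ++ List.range (g + 1))
    (appList (.var i.val) ((List.range' (g + 1) (ar i)).map .var))

/-- Simultaneous (sequential, for closed replacements) substitution. -/
def substL (M : Tm) (xs : List ℕ) (Ns : List Tm) : Tm :=
  (xs.zip Ns).foldl (fun acc p => Tm.subst acc p.1 p.2) M

/-- The terms `CON^i_{x₁,…,x_m}` (free variables `x_t = g+1+t`), defined by
downward recursion on `ar i - m` (the first argument is the fuel
`ar i - m`): the base case is `λy₁…λy_g.λz.yᵢ x₁…x_{ar i}`, the step case is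
`λy. y N^m_{1,i} … N^m_{g,i} L^m_i` with
`N^m_{j,i} = λz₁…z_{ar j}.(λx_{m+1}.CON^i_{x₁,…,x_{m+1}}) CON^j_{z₁,…,z_{ar j}}`
and `L^m_i = λz_{m+2}…λz_{ar i}.⊥`. -/
def CONf (g : ℕ) (ar : Fin g → ℕ) : ℕ → Fin g → List ℕ → Tm
  | 0, i, xs => lams (List.range (g + 1)) (appList (.var i.val) (xs.map .var))
  | (k+1), i, xs =>
      Tm.lam (2 * (g + 2 + Finset.univ.sup ar) + 2)
        (appList (.var (2 * (g + 2 + Finset.univ.sup ar) + 2))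
          ((List.ofFn fun j : Fin g =>
              lams (List.range' (g + 2 + Finset.univ.sup ar) (ar j))
                (Tm.app
                  (Tm.lam (g + 1 + xs.length)
                    (CONf g ar k i (xs ++ [g + 1 + xs.length])))
                  (CONf g ar 0 j
                    (List.range' (g + 2 + Finset.univ.sup ar) (ar j))))) ++
            [lams (List.range' (g + 2 + Finset.univ.sup ar) (ar i - xs.length - 1))
              (errTm g)]))
termination_by k => k

/-- `CON^i_{x₁,…,x_m}` with the canonical variable names `x_t = g+1+t`. -/
def CON (g : ℕ) (ar : Fin g → ℕ) (i : Fin g) (m : ℕ) : Tm :=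
  CONf g ar (ar i - m) i ((List.range m).map (g + 1 + ·))

/-- Patterns: terms built from constructors and variables. -/
inductive Pat : Type
  | pv : ℕ → Pat
  | pc : ℕ → List Pat → Pat

namespace Pat

/-- Well-formed patterns over the signature. -/
inductive WFP (g : ℕ) (ar : Fin g → ℕ) : Pat → Prop
  | pv (x) : WFP g ar (pv x)
  | pc {i : ℕ} {ps : List Pat} (h : i < g) :
      ps.length = ar ⟨i, h⟩ → (∀ p ∈ ps, WFP g ar p) → WFP g ar (pc i ps)

/-- The variables of a pattern, in left-to-right order. -/
def vars : Pat → List ℕ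
  | pv x => [x]
  | pc _ ps => (ps.attach.map fun p => vars p.1).flatten
termination_by p => sizeOf p
decreasing_by all_goals first
  | (simp_wf; have := List.sizeOf_lt_of_mem p.2; omega)
  | (simp_wf; omega)
  | simp_wf

/-- Instantiation of a pattern by a substitution assigning constructor terms
to variables. -/
def inst (σ : ℕ → CTm) : Pat → CTm
  | pv x => σ x
  | pc i ps => CTm.mk i (ps.attach.map fun p => inst σ p.1)
termination_by p => sizeOf p
decreasing_by all_goals first
  | (simp_wf; have := List.sizeOf_lt_of_mem p.2; omega)
  | (simp_wf; omega)
  | simp_wf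

end Pat

/-- A sequence of constructor terms matches a sequence of patterns when it is
obtained by instantiating the pattern variables with constructor terms. -/
def MatchesSeq (α : List Pat) (ts : List CTm) : Prop :=
  ∃ σ : ℕ → CTm, ts = α.map (Pat.inst σ)

/-- The variables of a sequence of patterns, in order. -/
def seqVars (α : List Pat) : List ℕ := (α.map Pat.vars).flatten

namespace Tm

/-- Simultaneous substitution of the terms `ρ x` for the free variables `x`. -/
def close (ρ : ℕ → Tm) : Tm → Tm
  | var x => ρ x
  | lam x P => lam x (close (Function.update ρ x (var x)) P)
  | app P Q => app (close ρ P) (close ρ Q)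

theorem subst_of_notMem_fv {M : Tm} {x : ℕ} {N : Tm} (h : x ∉ fv M) : subst M x N = M := by
  induction M with
  | var y => simp only [fv, Finset.mem_singleton] at h; simp [subst, Ne.symm h]
  | lam y P ih =>
    simp only [fv, Finset.mem_sdiff, Finset.mem_singleton, not_and, not_not] at h
    by_cases hy : y = x
    · simp [subst, hy]
    · simp only [subst, hy, if_false]
      rw [ih fun hx => hy (h hx).symm]
  | app P Q ihP ihQ =>
    simp only [fv, Finset.mem_union, not_or] at h
    simp [subst, ihP h.1, ihQ h.2]

theorem subst_close (M : Tm) (x : ℕ) (V : Tm) (ρ : ℕ → Tm)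
    (hρ : ∀ y, ρ y = var y ∨ Closed (ρ y)) :
    subst (close (Function.update ρ x (var x)) M) x V = close (Function.update ρ x V) M := by
  induction M generalizing ρ with
  | var y =>
    by_cases hy : y = x
    · subst hy; simp [close, subst]
    · simp only [close, Function.update_of_ne hy]
      rcases hρ y with h | h
      · simp [h, subst, hy]
      · exact subst_of_notMem_fv (by simp [show fv (ρ y) = ∅ from h])
  | lam y P ih =>
    by_cases hy : y = x
    · subst hy; simp [close, subst]
    · simp only [close, subst, hy, if_false]
      rw [Function.update_comm (Ne.symm hy), Function.update_comm (Ne.symm hy), ih]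
      intro z
      by_cases hz : z = y
      · subst hz; simp
      · simpa [Function.update_of_ne hz] using hρ z
  | app P Q ihP ihQ => simp [close, subst, ihP ρ hρ, ihQ ρ hρ]

theorem fv_close_subset {M : Tm} {ρ : ℕ → Tm} {S : Finset ℕ} (h : ∀ x ∈ fv M, fv (ρ x) ⊆ S) :
    fv (close ρ M) ⊆ S := by
  induction M generalizing ρ S with
  | var y => exact h y (by simp [fv])
  | lam y P ih =>
    have : fv (close (Function.update ρ y (var y)) P) ⊆ insert y S := by
      refine ih fun x hx => ?_
      by_cases hy : x = y
      · subst hy; simp [fv]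
      · rw [Function.update_of_ne hy]
        exact (h x (by simp [fv, hx, hy])).trans (Finset.subset_insert _ _)
    intro z hz
    simp only [close, fv, Finset.mem_sdiff, Finset.mem_singleton] at hz
    exact (Finset.mem_insert.1 (this hz.1)).resolve_left hz.2
  | app P Q ihP ihQ =>
    exact Finset.union_subset (ihP fun x hx => h x (by simp [fv, hx]))
      (ihQ fun x hx => h x (by simp [fv, hx]))

theorem close_eq_self {M : Tm} {ρ : ℕ → Tm} (h : ∀ x ∈ fv M, ρ x = var x) : close ρ M = M := by
  induction M generalizing ρ with
  | var y => exact h y (by simp [fv])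
  | lam y P ih =>
    rw [close, ih]
    intro x hx
    by_cases hy : x = y
    · subst hy; simp
    · rw [Function.update_of_ne hy]
      exact h x (by simp [fv, hx, hy])
  | app P Q ihP ihQ =>
    rw [close, ihP fun x hx => h x (by simp [fv, hx]), ihQ fun x hx => h x (by simp [fv, hx])]

theorem Closed.close_eq {M : Tm} (h : Closed M) (ρ : ℕ → Tm) : close ρ M = M :=
  close_eq_self (by simp [show fv M = ∅ from h])

theorem closed_close {ρ : ℕ → Tm} (hρ : ∀ x, Closed (ρ x)) (M : Tm) : Closed (close ρ M) :=
  Finset.subset_empty.1 (fv_close_subset fun x _ => by rw [show fv (ρ x) = ∅ from hρ x])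

theorem close_appList (ρ : ℕ → Tm) (M : Tm) (Ns : List Tm) :
    close ρ (appList M Ns) = appList (close ρ M) (Ns.map (close ρ)) := by
  induction Ns generalizing M with
  | nil => rfl
  | cons N Ns ih => exact ih (app M N)

theorem fv_lams (xs : List ℕ) (M : Tm) : fv (lams xs M) = fv M \ xs.toFinset := by
  induction xs with
  | nil => simp [lams]
  | cons x xs ih =>
    change fv (lams xs M) \ {x} = _
    rw [ih]
    ext y
    simp only [Finset.mem_sdiff, List.mem_toFinset, Finset.mem_singleton, List.mem_cons]
    tauto

theorem fv_appList_subset {M : Tm} {Ns : List Tm} {S : Finset ℕ} (hM : fv M ⊆ S)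
    (hN : ∀ N ∈ Ns, fv N ⊆ S) : fv (appList M Ns) ⊆ S := by
  induction Ns generalizing M with
  | nil => exact hM
  | cons N Ns ih =>
    exact ih (M := app M N) (Finset.union_subset hM (hN N (by simp)))
      fun N' h => hN N' (by simp [h])

theorem appList_append (M : Tm) (Ns Ps : List Tm) :
    appList M (Ns ++ Ps) = appList (appList M Ns) Ps := by
  simp [appList]

/-- Reduction in at most `l` weak call-by-value steps. -/
def Red (l : ℕ) (a b : Tm) : Prop := ∃ k ≤ l, stepsN Cbv k a b

theorem Red.refl (l : ℕ) (a : Tm) : Red l a a := ⟨0, Nat.zero_le _, rfl⟩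

theorem Red.mono {l l' : ℕ} {a b : Tm} (h : Red l a b) (hl : l ≤ l') : Red l' a b :=
  let ⟨k, hk, hs⟩ := h
  ⟨k, hk.trans hl, hs⟩

theorem stepsN_trans {j k : ℕ} {a b c : Tm} (h₁ : stepsN Cbv j a b) (h₂ : stepsN Cbv k b c) :
    stepsN Cbv (j + k) a c := by
  induction j generalizing a with
  | zero => obtain rfl : a = b := h₁; simpa using h₂
  | succ j ih =>
    obtain ⟨d, hd, hs⟩ := h₁
    rw [Nat.succ_add]
    exact ⟨d, hd, ih hs⟩

theorem Red.trans {l l' : ℕ} {a b c : Tm} (h₁ : Red l a b) (h₂ : Red l' b c) :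
    Red (l + l') a c :=
  let ⟨j, hj, hs⟩ := h₁
  let ⟨k, hk, ht⟩ := h₂
  ⟨j + k, Nat.add_le_add hj hk, stepsN_trans hs ht⟩

theorem Cbv.red {a b : Tm} (h : Cbv a b) : Red 1 a b := ⟨1, le_rfl, b, h, rfl⟩

theorem Cbv.appList {a b : Tm} (h : Cbv a b) (Ns : List Tm) :
    Cbv (appList a Ns) (appList b Ns) := by
  induction Ns generalizing a b with
  | nil => exact h
  | cons N Ns ih => exact ih (Cbv.appL (L := N) h)

theorem Red.appList {l : ℕ} {a b : Tm} (h : Red l a b) (Ns : List Tm) :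
    Red l (appList a Ns) (appList b Ns) := by
  obtain ⟨k, hk, hs⟩ := h
  refine ⟨k, hk, ?_⟩
  clear hk
  induction k generalizing a with
  | zero => exact congrArg (fun M => _root_.appList M Ns) hs
  | succ k ih =>
    obtain ⟨d, hd, hs⟩ := hs
    exact ⟨_, hd.appList Ns, ih hs⟩

/-- The environment `ρ` with the entries from index `s` on overwritten by the list `Vs`. -/
def overwrite (ρ : ℕ → Tm) (s : ℕ) (Vs : List Tm) (x : ℕ) : Tm :=
  if x < s then ρ x else (Vs[x - s]?).getD (ρ x)

theorem overwrite_of_lt (ρ : ℕ → Tm) {s : ℕ} (Vs : List Tm) {x : ℕ} (h : x < s) :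
    overwrite ρ s Vs x = ρ x := by
  simp [overwrite, h]

theorem overwrite_add (ρ : ℕ → Tm) (s : ℕ) {Vs : List Tm} {i : ℕ} (h : i < Vs.length) :
    overwrite ρ s Vs (s + i) = Vs[i] := by
  simp [overwrite, h]

theorem overwrite_cons (ρ : ℕ → Tm) (s : ℕ) (V : Tm) (Vs : List Tm) :
    overwrite (Function.update ρ s V) (s + 1) Vs = overwrite ρ s (V :: Vs) := by
  funext x
  rcases lt_trichotomy x s with h | rfl | h
  · simp [overwrite, h, h.ne, Nat.lt_succ_of_lt h]
  · simp [overwrite]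
  · obtain ⟨d, rfl⟩ := Nat.exists_eq_add_of_lt h
    have h₁ : s + d + 1 - (s + 1) = d := by omega
    have h₂ : s + d + 1 - s = d + 1 := by omega
    have h₃ : ¬ s + d + 1 < s := by omega
    have h₄ : s + d + 1 ≠ s := by omega
    simp [overwrite, h₁, h₂, h₃, h₄]

theorem overwrite_nil (ρ : ℕ → Tm) (s : ℕ) : overwrite ρ s [] = ρ := by
  funext x; simp [overwrite]

theorem closed_overwrite {ρ : ℕ → Tm} (hρ : ∀ x, Closed (ρ x)) (s : ℕ) {Vs : List Tm}
    (hV : ∀ V ∈ Vs, Closed V) (x : ℕ) : Closed (overwrite ρ s Vs x) := by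
  unfold overwrite
  split_ifs
  · exact hρ x
  · cases h : Vs[x - s]? with
    | none => exact hρ x
    | some V => exact hV V (List.mem_of_getElem? h)

theorem map_overwrite_range' (ρ : ℕ → Tm) (s : ℕ) (Vs : List Tm) :
    (List.range' s Vs.length).map (overwrite ρ s Vs) = Vs := by
  refine List.ext_getElem (by simp) fun i h _ => ?_
  simp only [List.length_map, List.length_range'] at h
  simp [overwrite_add ρ s h]

theorem map_overwrite_of_lt (ρ : ℕ → Tm) {s : ℕ} (Vs : List Tm) {xs : List ℕ}
    (h : ∀ x ∈ xs, x < s) : xs.map (overwrite ρ s Vs) = xs.map ρ :=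
  List.map_congr_left fun x hx => overwrite_of_lt ρ Vs (h x hx)

theorem red_appList_lams {ρ : ℕ → Tm} (hρ : ∀ x, Closed (ρ x)) (s : ℕ) (P : Tm)
    (Vs : List Tm) (hV : ∀ V ∈ Vs, Closed V ∧ IsValue V) :
    Red Vs.length (appList (close ρ (lams (List.range' s Vs.length) P)) Vs)
      (close (overwrite ρ s Vs) P) := by
  induction Vs generalizing ρ s with
  | nil => rw [overwrite_nil]; exact Red.refl _ _
  | cons V Vs ih =>
    obtain ⟨hVc, hVv⟩ := hV V (by simp)
    have hstep : Cbv (app (close ρ (lams (List.range' s (V :: Vs).length) P)) V)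
        (close (Function.update ρ s V) (lams (List.range' (s + 1) Vs.length) P)) := by
      rw [← subst_close _ _ _ _ fun y => Or.inr (hρ y)]
      exact Cbv.beta hVv
    have hρ' : ∀ x, Closed (Function.update ρ s V x) := by
      intro x
      by_cases hx : x = s
      · subst hx; simpa using hVc
      · simpa [hx] using hρ x
    have := (hstep.appList Vs).red.trans
      (ih hρ' (s + 1) fun W hW => hV W (by simp [hW]))
    rw [overwrite_cons] at this
    exact this.mono (by simp [Nat.add_comm])

/-- Closing `M` only depends on the values of the environment at the variables below `c`. -/
def Below (c : ℕ) (M : Tm) : Prop :=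
  ∀ ρ ρ' : ℕ → Tm, (∀ x < c, ρ x = ρ' x) → close ρ M = close ρ' M

theorem Below.mono {b c : ℕ} {M : Tm} (h : Below b M) (hbc : b ≤ c) : Below c M :=
  fun ρ ρ' hr => h ρ ρ' fun x hx => hr x (hx.trans_le hbc)

theorem Below.overwrite {c s : ℕ} {M : Tm} (h : Below c M) (hcs : c ≤ s) (ρ : ℕ → Tm)
    (Vs : List Tm) : close (overwrite ρ s Vs) M = close ρ M :=
  h _ _ fun _ hx => overwrite_of_lt ρ Vs (hx.trans_le hcs)

theorem below_var {c x : ℕ} (h : x < c) : Below c (var x) := fun _ _ hr => hr x h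

theorem Closed.below {M : Tm} (h : Closed M) (c : ℕ) : Below c M :=
  fun ρ ρ' _ => by rw [h.close_eq, h.close_eq]

theorem Below.appList {c : ℕ} {M : Tm} {Ns : List Tm} (hM : Below c M)
    (hN : ∀ N ∈ Ns, Below c N) : Below c (appList M Ns) := by
  intro ρ ρ' hr
  rw [close_appList, close_appList, hM ρ ρ' hr]
  congr 1
  exact List.map_congr_left fun N h => hN N h ρ ρ' hr

theorem Below.lams {c k : ℕ} {M : Tm} (h : Below (c + k) M) :
    Below c (lams (List.range' c k) M) := by
  induction k generalizing c with
  | zero => exact h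
  | succ k ih =>
    intro ρ ρ' hr
    change lam c _ = lam c _
    congr 1
    refine ih (c := c + 1) (h.mono (by omega)) _ _ fun x hx => ?_
    by_cases hxc : x = c
    · subst hxc; simp
    · simp only [Function.update_of_ne hxc]
      exact hr x (by omega)

end Tm

open Tm in
theorem closed_errTm (g : ℕ) : Closed (errTm g) := by
  unfold Closed errTm
  rw [fv_lams]
  simp [fv, Finset.sdiff_eq_empty_iff_subset]

open Tm in
theorem isValue_errTm (g : ℕ) : IsValue (errTm g) := by
  unfold errTm
  rw [List.range_eq_range']
  trivial

namespace CTm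

theorem encode_mk (g i : ℕ) (ts : List CTm) :
    encode g (mk i ts) = lams (List.range (g + 1)) (appList (.var i) (ts.map (encode g))) := by
  rw [encode]
  simp

theorem WFC.closed_encode {g : ℕ} {ar : Fin g → ℕ} {t : CTm} (h : WFC g ar t) :
    Tm.Closed (encode g t) := by
  induction h with
  | @mk i ts hi _ _ ih =>
    unfold Tm.Closed
    rw [encode_mk, Tm.fv_lams, Finset.sdiff_eq_empty_iff_subset]
    refine Tm.fv_appList_subset (by simp [Tm.fv]; omega) fun N hN => ?_
    obtain ⟨t, ht, rfl⟩ := List.mem_map.1 hN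
    rw [show Tm.fv (encode g t) = ∅ from ih t ht]
    exact Finset.empty_subset _

theorem isValue_encode (g : ℕ) (t : CTm) : Tm.IsValue (encode g t) := by
  obtain ⟨i, ts⟩ := t
  rw [encode_mk, List.range_eq_range']
  trivial

end CTm

namespace Pat

theorem vars_pc (i : ℕ) (ps : List Pat) : vars (pc i ps) = seqVars ps := by
  rw [vars, seqVars]
  simp

theorem vars_pv (x : ℕ) : vars (pv x) = [x] := by rw [vars]

theorem inst_pc (σ : ℕ → CTm) (i : ℕ) (ps : List Pat) :
    inst σ (pc i ps) = .mk i (ps.map (inst σ)) := by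
  rw [inst]
  simp

theorem inst_pv (σ : ℕ → CTm) (x : ℕ) : inst σ (pv x) = σ x := by rw [inst]

theorem WFP.inst_congr {g : ℕ} {ar : Fin g → ℕ} {p : Pat} (h : WFP g ar p) {σ τ : ℕ → CTm}
    (hs : ∀ x ∈ vars p, σ x = τ x) : inst σ p = inst τ p := by
  induction h with
  | pv x => simpa [inst_pv, vars_pv] using hs
  | @pc i ps _ _ _ ih =>
    rw [inst_pc, inst_pc]
    congr 1
    refine List.map_congr_left fun p hp => ih p hp fun x hx => hs x ?_
    rw [vars_pc, seqVars, List.mem_flatten]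
    exact ⟨_, List.mem_map_of_mem hp, hx⟩

theorem WFP.wfc_inst {g : ℕ} {ar : Fin g → ℕ} {p : Pat} (h : WFP g ar p) {σ : ℕ → CTm}
    (hs : ∀ x, CTm.WFC g ar (σ x)) : CTm.WFC g ar (inst σ p) := by
  induction h with
  | pv x => rw [inst_pv]; exact hs x
  | @pc i ps hi hl _ ih =>
    rw [inst_pc]
    refine .mk hi (by simpa using hl) fun t ht => ?_
    obtain ⟨p, hp, rfl⟩ := List.mem_map.1 ht
    exact ih p hp

theorem sizeOf_append_add_one (ps qs : List Pat) :
    sizeOf (ps ++ qs) + 1 = sizeOf ps + sizeOf qs := by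
  induction ps with
  | nil => simp [Nat.add_comm]
  | cons p ps ih => simp only [List.cons_append, List.cons.sizeOf_spec]; omega

end Pat

theorem seqVars_pv_cons (y : ℕ) (ps : List Pat) :
    seqVars (.pv y :: ps) = y :: seqVars ps := by
  simp [seqVars, Pat.vars_pv]

theorem seqVars_pc_cons (i : ℕ) (qs ps : List Pat) :
    seqVars (.pc i qs :: ps) = seqVars (qs ++ ps) := by
  simp [seqVars, Pat.vars_pc]

theorem MatchesSeq.pv_cons {g : ℕ} {ar : Fin g → ℕ} {y : ℕ} {ps : List Pat} {ts : List CTm}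
    (h : MatchesSeq ps ts) (t : CTm) (hwf : ∀ p ∈ ps, Pat.WFP g ar p) (hy : y ∉ seqVars ps) :
    MatchesSeq (.pv y :: ps) (t :: ts) := by
  obtain ⟨σ, rfl⟩ := h
  refine ⟨Function.update σ y t, ?_⟩
  rw [List.map_cons, Pat.inst_pv, Function.update_self]
  congr 1
  refine List.map_congr_left fun p hp => (hwf p hp).inst_congr fun x hx => ?_
  rw [Function.update_of_ne]
  rintro rfl
  exact hy (List.mem_flatten.2 ⟨_, List.mem_map_of_mem hp, hx⟩)

theorem cons_eq_map_inst_pc_cons_iff {i : ℕ} {qs ps : List Pat} {us ts : List CTm}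
    (hl : us.length = qs.length) (σ : ℕ → CTm) :
    CTm.mk i us :: ts = (Pat.pc i qs :: ps).map (Pat.inst σ) ↔
      us ++ ts = (qs ++ ps).map (Pat.inst σ) := by
  rw [List.map_cons, Pat.inst_pc, List.map_append]
  constructor
  · intro h
    injection h with h₁ h₂
    injection h₁ with _ h₁
    rw [h₁, h₂]
  · intro h
    obtain ⟨h₁, h₂⟩ := List.append_inj h (by simpa using hl)
    rw [h₁, h₂]

open Tm

/-- Case analysis on the encoded constructor term held by the variable `x`. The branch for the
constructor `j` binds its arguments to the variables `c, …, c + ar j - 1`; a dummy argument delays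
the evaluation of the branches. -/
def caseTm {g : ℕ} (ar : Fin g → ℕ) (c x : ℕ) (B : Fin g → Tm) (E : Tm) : Tm :=
  appList (.var x) ((List.ofFn (fun j => lams (List.range' c (ar j + 1)) (B j)) ++
    [lams (List.range' c 1) E]) ++ [errTm g])

section CaseAnalysis

variable {g : ℕ} {ar : Fin g → ℕ}

theorem below_caseTm {c x : ℕ} {B : Fin g → Tm} {E : Tm} (hx : x < c)
    (hB : ∀ j, Below (c + (ar j + 1)) (B j)) (hE : Below (c + 1) E) :
    Below c (caseTm ar c x B E) := by
  refine (below_var hx).appList fun N hN => ?_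
  simp only [List.mem_append, List.mem_ofFn, List.mem_singleton] at hN
  rcases hN with (⟨j, rfl⟩ | rfl) | rfl
  · exact (hB j).lams
  · exact hE.lams
  · exact (closed_errTm g).below c

/-- The selector `λ x₀ … x_g. xᵢ N₁ … Nₖ` passes the arguments `N₁ … Nₖ` to the branch of
index `i`. -/
theorem red_select {S : Tm} {i : ℕ} (Ns Bs : List Tm) (D : Tm) (hBl : Bs.length = g + 1)
    (hi : i < Bs.length) (hS : S = lams (List.range (g + 1)) (appList (.var i) Ns))
    (hSc : Closed S) (hN : ∀ N ∈ Ns, Closed N) (hB : ∀ N ∈ Bs, Closed N ∧ IsValue N) :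
    Red (g + 1) (appList S (Bs ++ [D])) (appList Bs[i] (Ns ++ [D])) := by
  have h := red_appList_lams (ρ := fun _ => errTm g) (fun _ => closed_errTm g) 0
    (appList (.var i) Ns) Bs hB
  rw [hBl, ← List.range_eq_range', ← hS, hSc.close_eq, close_appList] at h
  have hNs : Ns.map (close (overwrite (fun _ => errTm g) 0 Bs)) = Ns := by
    conv_rhs => rw [← List.map_id Ns]
    exact List.map_congr_left fun N hN' => (hN N hN').close_eq _
  have hv : close (overwrite (fun _ => errTm g) 0 Bs) (.var i) = Bs[i] := by
    simpa [close] using overwrite_add (fun _ => errTm g) 0 hi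
  rw [hNs, hv] at h
  rw [appList_append, appList_append]
  exact h.appList [D]

theorem red_caseTm_encode {ρ : ℕ → Tm} (hρ : ∀ x, Closed (ρ x)) {c x : ℕ} {B : Fin g → Tm}
    {E : Tm} {i : ℕ} (hi : i < g) {us : List CTm} (hl : us.length = ar ⟨i, hi⟩)
    (hus : ∀ u ∈ us, CTm.WFC g ar u) (hx : ρ x = CTm.encode g (.mk i us)) :
    Red (g + 1 + (Finset.univ.sup ar + 1)) (close ρ (caseTm ar c x B E))
      (close (overwrite ρ c (us.map (CTm.encode g) ++ [errTm g])) (B ⟨i, hi⟩)) := by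
  have henc : ∀ N ∈ us.map (CTm.encode g), Closed N ∧ IsValue N := by
    intro N hN
    obtain ⟨u, hu, rfl⟩ := List.mem_map.1 hN
    exact ⟨(hus u hu).closed_encode, CTm.isValue_encode g u⟩
  rw [caseTm, close_appList, List.map_append]
  simp only [List.map_cons, List.map_nil, (closed_errTm g).close_eq]
  have h := red_select (g := g) (S := close ρ (.var x)) (i := i) (us.map (CTm.encode g))
    ((List.ofFn (fun j => lams (List.range' c (ar j + 1)) (B j)) ++
      [lams (List.range' c 1) E]).map (close ρ)) (errTm g) (by simp) (by simp; omega)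
    (by rw [close, hx, CTm.encode_mk]) (hρ x) (fun N hN => (henc N hN).1) (by
      intro N hN
      simp only [List.mem_map, List.mem_append, List.mem_ofFn, List.mem_singleton] at hN
      obtain ⟨P, ⟨j, rfl⟩ | rfl, rfl⟩ := hN <;> exact ⟨closed_close hρ _, trivial⟩)
  refine h.trans ?_
  have hb := red_appList_lams hρ c (B ⟨i, hi⟩) (us.map (CTm.encode g) ++ [errTm g]) (by
    intro N hN
    rcases List.mem_append.1 hN with hN | hN
    · exact henc N hN
    · rw [List.mem_singleton.1 hN]
      exact ⟨closed_errTm g, isValue_errTm g⟩)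
  have hle : ar ⟨i, hi⟩ ≤ Finset.univ.sup ar := Finset.le_sup (Finset.mem_univ _)
  rw [List.getElem_map, List.getElem_append_left (by simpa using hi), List.getElem_ofFn]
  simp only [List.length_append, List.length_map, hl, List.length_singleton] at hb
  exact hb.mono (by omega)

theorem red_caseTm_errTm {ρ : ℕ → Tm} (hρ : ∀ x, Closed (ρ x)) {c x : ℕ} {B : Fin g → Tm}
    {E : Tm} (hx : ρ x = errTm g) :
    Red (g + 2) (close ρ (caseTm ar c x B E)) (close (overwrite ρ c [errTm g]) E) := by
  rw [caseTm, close_appList, List.map_append]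
  simp only [List.map_cons, List.map_nil, (closed_errTm g).close_eq]
  have h := red_select (g := g) (S := close ρ (.var x)) (i := g) []
    ((List.ofFn (fun j => lams (List.range' c (ar j + 1)) (B j)) ++
      [lams (List.range' c 1) E]).map (close ρ)) (errTm g) (by simp) (by simp)
    (by rw [close, hx]; rfl) (hρ x) (by simp) (by
      intro N hN
      simp only [List.mem_map, List.mem_append, List.mem_ofFn, List.mem_singleton] at hN
      obtain ⟨P, ⟨j, rfl⟩ | rfl, rfl⟩ := hN <;> exact ⟨closed_close hρ _, trivial⟩)
  refine h.trans (l' := 1) ?_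
  have hb := red_appList_lams hρ c E [errTm g] (by simp [closed_errTm, isValue_errTm])
  rw [List.getElem_map, List.getElem_append_right (by simp)]
  simpa using hb

/-- Code which matches the terms held by the variables `xs` against the patterns `ps`: on success
the variable `v` is applied to the variables `acc` followed by the instantiating terms, on failure
the code `F` is run. -/
theorem exists_match_code {v b : ℕ} {F : Tm} (hF : Below b F) (ps : List Pat)
    (hwf : ∀ p ∈ ps, Pat.WFP g ar p) (hnd : (seqVars ps).Nodup) (xs acc : List ℕ) (c : ℕ)
    (hlen : xs.length = ps.length) (hxs : ∀ x ∈ xs, x < c) (hacc : ∀ x ∈ acc, x < c)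
    (hv : v < c) (hbc : b ≤ c) :
    ∃ (M : Tm) (l : ℕ), Below c M ∧ ∀ ρ : ℕ → Tm, (∀ x, Closed (ρ x)) →
      ∀ ts : List CTm, (∀ t ∈ ts, CTm.WFC g ar t) → xs.map ρ = ts.map (CTm.encode g) →
        (∀ σ, ts = ps.map (Pat.inst σ) → Red l (close ρ M)
          (appList (ρ v) (acc.map ρ ++ (seqVars ps).map fun x => CTm.encode g (σ x)))) ∧
        (¬ MatchesSeq ps ts → Red l (close ρ M) (close ρ F)) := by
  match ps, xs, hlen with
  | [], [], _ =>
    refine ⟨appList (.var v) (acc.map .var), 0, (below_var hv).appList ?_, ?_⟩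
    · simp only [List.mem_map, forall_exists_index, and_imp]
      rintro _ x hx rfl
      exact below_var (hacc x hx)
    · intro ρ _ ts _ hts
      obtain rfl : ts = [] := by simpa using hts.symm
      refine ⟨fun σ _ => ?_, fun h => (h ⟨fun _ => .mk 0 [], rfl⟩).elim⟩
      rw [close_appList, List.map_map]
      simpa [seqVars, close, Function.comp_def] using Red.refl 0 (appList (ρ v) (acc.map ρ))
  | .pv y :: ps, x :: xs, hlen =>
    rw [seqVars_pv_cons, List.nodup_cons] at hnd
    simp only [List.mem_cons, forall_eq_or_imp] at hwf hxs
    obtain ⟨M, l, hM, h⟩ := exists_match_code hF ps hwf.2 hnd.2 xs (acc ++ [x]) c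
      (by simpa using hlen) hxs.2 (by
        simp only [List.mem_append, List.mem_singleton]
        rintro z (hz | rfl)
        exacts [hacc z hz, hxs.1]) hv hbc
    refine ⟨M, l, hM, fun ρ hρ ts hts hxt => ?_⟩
    match ts, hts, hxt with
    | t :: ts, hts, hxt =>
      simp only [List.map_cons, List.cons.injEq] at hxt
      obtain ⟨hp, hn⟩ := h ρ hρ ts (fun t ht => hts t (by simp [ht])) hxt.2
      refine ⟨fun σ hσ => ?_, fun hm => hn fun hm' => hm (hm'.pv_cons t hwf.2 hnd.1)⟩
      simp only [List.map_cons, Pat.inst_pv, List.cons.injEq] at hσ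
      have := hp σ hσ.2
      rw [seqVars_pv_cons]
      simpa [hxt.1, hσ.1] using this
  | .pc i qs :: ps, x :: xs, hlen =>
    rw [seqVars_pc_cons] at hnd
    simp only [List.mem_cons, forall_eq_or_imp] at hwf hxs
    obtain ⟨_ | ⟨hi, hql, hqs⟩, hps⟩ := hwf
    obtain ⟨M, l, hM, h⟩ := exists_match_code (v := v) hF (qs ++ ps)
      (by simpa [or_imp, forall_and] using ⟨hqs, hps⟩) hnd
      (List.range' c (ar ⟨i, hi⟩) ++ xs) acc (c + (ar ⟨i, hi⟩ + 1))
      (by simpa [hql] using hlen)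
      (by
        intro z hz
        simp only [List.mem_append, List.mem_range'_1] at hz
        rcases hz with hz | hz
        · omega
        · have := hxs.2 z hz; omega)
      (fun z hz => (hacc z hz).trans_le (by omega)) (by omega) (by omega)
    refine ⟨caseTm ar c x (fun j => if j = ⟨i, hi⟩ then M else F) F,
      g + 1 + (Finset.univ.sup ar + 1) + l, below_caseTm hxs.1 ?_ (hF.mono (hbc.trans c.le_succ)), ?_⟩
    · intro j
      by_cases hj : j = ⟨i, hi⟩
      · subst hj; simpa using hM
      · simpa [hj] using hF.mono (c := c + (ar j + 1)) (hbc.trans (Nat.le_add_right _ _))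
    intro ρ hρ ts hts hxt
    match ts, hts, hxt with
    | t :: ts, hts, hxt =>
      simp only [List.map_cons, List.cons.injEq] at hxt
      simp only [List.mem_cons, forall_eq_or_imp] at hts
      obtain ⟨⟨hj, hul, hus⟩, hts⟩ := hts
      rename_i j us
      have hred := red_caseTm_encode (c := c) (E := F)
        (B := fun j => if j = ⟨i, hi⟩ then M else F) hρ hj hul hus hxt.1
      by_cases hji : j = i
      · subst hji
        simp only [if_true] at hred
        set ρ' := overwrite ρ c (us.map (CTm.encode g) ++ [errTm g]) with hρ'
        have hlu : us.length = qs.length := hul.trans hql.symm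
        have hus' : (List.range' c (ar ⟨j, hi⟩)).map ρ' = us.map (CTm.encode g) := by
          have := map_overwrite_range' ρ c (us.map (CTm.encode g) ++ [errTm g])
          rw [List.length_append, List.length_map, hul, List.length_singleton,
            List.range'_concat, List.map_append] at this
          exact (List.append_inj this (by simp [hul])).1
        have hxs' : xs.map ρ' = xs.map ρ := map_overwrite_of_lt ρ _ hxs.2
        have hacc' : acc.map ρ' = acc.map ρ := map_overwrite_of_lt ρ _ hacc
        have hv' : ρ' v = ρ v := overwrite_of_lt ρ _ hv
        have hc : ∀ z, Closed (ρ' z) := by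
          refine closed_overwrite hρ c fun N hN => ?_
          simp only [List.mem_append, List.mem_map, List.mem_singleton] at hN
          rcases hN with ⟨u, hu, rfl⟩ | rfl
          exacts [(hus u hu).closed_encode, closed_errTm g]
        obtain ⟨hp, hn⟩ := h ρ' hc (us ++ ts)
          (by simpa [or_imp, forall_and] using ⟨hus, hts⟩)
          (by rw [List.map_append, List.map_append, hus', hxs', hxt.2])
        rw [hacc', hv'] at hp
        rw [hρ', hF.overwrite hbc, ← hρ'] at hn
        refine ⟨fun σ hσ => ?_, fun hm => ?_⟩
        · rw [seqVars_pc_cons]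
          exact hred.trans (hp σ ((cons_eq_map_inst_pc_cons_iff hlu σ).1 hσ))
        · refine hred.trans (hn fun ⟨σ, hσ⟩ => hm ⟨σ, ?_⟩)
          exact (cons_eq_map_inst_pc_cons_iff hlu σ).2 hσ
      · simp only [Fin.mk.injEq, hji, if_false] at hred
        rw [hF.overwrite hbc] at hred
        refine ⟨fun σ hσ => ?_, fun _ => hred.mono (by omega)⟩
        rw [List.map_cons, Pat.inst_pc] at hσ
        injection hσ with h₁
        injection h₁ with h₁
        exact (hji h₁).elim
termination_by sizeOf ps
decreasing_by
  · simp
  · have := Pat.sizeOf_append_add_one qs ps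
    simp
    omega

/-- Code which tries the pattern sequences `α i`, for `i` in a list, one after the other. -/
theorem exists_first_match_code {n m : ℕ} {α : Fin n → List Pat} (hlen : ∀ i, (α i).length = m)
    (hwf : ∀ i, ∀ p ∈ α i, Pat.WFP g ar p) (hlin : ∀ i, (seqVars (α i)).Nodup)
    (is : List (Fin n)) :
    ∃ (M : Tm) (l : ℕ), Below (m + n) M ∧ ∀ ρ : ℕ → Tm, (∀ x, Closed (ρ x)) →
      ∀ ts : List CTm, (∀ t ∈ ts, CTm.WFC g ar t) →
        (List.range' 0 m).map ρ = ts.map (CTm.encode g) →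
        (∀ i ∈ is, ∀ σ, ts = (α i).map (Pat.inst σ) →
          (∀ j, MatchesSeq (α j) ts → i = j) → Red l (close ρ M)
            (appList (ρ (m + i)) ((seqVars (α i)).map fun x => CTm.encode g (σ x)))) ∧
        ((∀ i ∈ is, ¬ MatchesSeq (α i) ts) → Red l (close ρ M) (errTm g)) := by
  induction is with
  | nil =>
    refine ⟨errTm g, 0, (closed_errTm g).below _, fun ρ _ ts _ _ => ⟨by simp, fun _ => ?_⟩⟩
    rw [(closed_errTm g).close_eq]
    exact Red.refl _ _
  | cons i is ih =>
    obtain ⟨F, k, hF, h⟩ := ih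
    obtain ⟨M, l, hM, hm⟩ := exists_match_code (v := m + i) hF (α i) (hwf i) (hlin i)
      (List.range' 0 m) [] (m + n) (by simp [hlen])
      (by simp only [List.mem_range'_1]; omega) (by simp) (by omega) le_rfl
    refine ⟨M, l + k, hM, fun ρ hρ ts hts hx => ?_⟩
    obtain ⟨hp, hn⟩ := hm ρ hρ ts hts hx
    obtain ⟨hp', hn'⟩ := h ρ hρ ts hts hx
    refine ⟨fun j hj σ hσ hu => ?_, fun hno => ?_⟩
    · by_cases hi : MatchesSeq (α i) ts
      · obtain rfl := hu i hi
        exact (hp σ hσ).mono (by omega)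
      · refine (hn hi).trans (hp' j ((List.mem_cons.1 hj).resolve_left ?_) σ hσ hu)
        rintro rfl
        exact hi ⟨σ, hσ⟩
    · exact (hn (hno i (by simp))).trans (hn' fun j hj => hno j (by simp [hj]))

/-- Code which returns `⊥` if one of the variables `xs` holds `⊥`, and runs `F` if all of them
hold encoded constructor terms. -/
theorem exists_check_code {c : ℕ} {F : Tm} (hF : Below c F) (xs : List ℕ)
    (hxs : ∀ x ∈ xs, x < c) :
    ∃ (M : Tm) (l : ℕ), Below c M ∧ ∀ ρ : ℕ → Tm, (∀ x, Closed (ρ x)) →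
      (∀ x ∈ xs, ρ x = errTm g ∨ ∃ t, CTm.WFC g ar t ∧ ρ x = CTm.encode g t) →
        (errTm g ∈ xs.map ρ → Red l (close ρ M) (errTm g)) ∧
        ((∀ x ∈ xs, ∃ t, CTm.WFC g ar t ∧ ρ x = CTm.encode g t) →
          Red l (close ρ M) (close ρ F)) := by
  induction xs with
  | nil => exact ⟨F, 0, hF, fun ρ _ _ => ⟨by simp, fun _ => Red.refl _ _⟩⟩
  | cons x xs ih =>
    simp only [List.mem_cons, forall_eq_or_imp] at hxs
    obtain ⟨M, l, hM, h⟩ := ih hxs.2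
    refine ⟨caseTm ar c x (fun _ => M) (errTm g), g + 1 + (Finset.univ.sup ar + 1) + l,
      below_caseTm hxs.1 (fun j => hM.mono (by omega)) ((closed_errTm g).below _),
      fun ρ hρ hv => ?_⟩
    simp only [List.mem_cons, forall_eq_or_imp] at hv
    obtain ⟨hp, hn⟩ := h ρ hρ hv.2
    have hred : (∃ t, CTm.WFC g ar t ∧ ρ x = CTm.encode g t) →
        Red (g + 1 + (Finset.univ.sup ar + 1))
          (close ρ (caseTm ar c x (fun _ => M) (errTm g))) (close ρ M) := by
      rintro ⟨_, ⟨hi, hl, hus⟩, hx⟩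
      have := red_caseTm_encode (c := c) (B := fun _ => M) (E := errTm g) hρ hi hl hus hx
      rwa [hM.overwrite le_rfl] at this
    refine ⟨fun he => ?_, fun ht => ?_⟩
    · by_cases hx : ρ x = errTm g
      · have := red_caseTm_errTm (ar := ar) (c := c) (B := fun _ => M) (E := errTm g) hρ hx
        rw [(closed_errTm g).close_eq] at this
        exact this.mono (by omega)
      · refine (hred (hv.1.resolve_left hx)).trans (hp ?_)
        simpa [Ne.symm hx] using he
    · simp only [List.mem_cons, forall_eq_or_imp] at ht
      exact (hred ht.1).trans (hn ht.2)

end CaseAnalysis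

/-- pattern matching in the λ-calculus: given non-overlapping,
left-linear sequences `α₁,…,αₙ` of well-formed patterns, each of length `m`,
there are a λ-term `PAT` and a bound `l` such that for all (closed) values
`V₁,…,Vₙ`: (a) if the arguments are encodings of constructor terms matching
`αᵢ` (via a substitution `σ` of constructor terms for the pattern variables),
then `PAT` applied to them and to `V₁,…,Vₙ` reduces in at most `l` weak CBV
steps to `Vᵢ` applied to the encodings of the instantiating terms; (b) if the
`m` arguments match none of the `αᵢ`, or one of them is `⊥`, then the
application reduces in at most `l` steps to `⊥`. -/
theorem pattern_matching (g : ℕ) (ar : Fin g → ℕ) (n m : ℕ)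
    (α : Fin n → List Pat)
    (hlen : ∀ i, (α i).length = m)
    (hwf : ∀ i, ∀ p ∈ α i, Pat.WFP g ar p)
    (hlin : ∀ i, (seqVars (α i)).Nodup)
    (hno : ∀ ts : List CTm, (∀ t ∈ ts, CTm.WFC g ar t) →
      ∀ i j, MatchesSeq (α i) ts → MatchesSeq (α j) ts → i = j) :
    ∃ (PAT : Tm) (l : ℕ),
      ∀ V : Fin n → Tm, (∀ i, Tm.IsValue (V i) ∧ Tm.Closed (V i)) →
        (∀ (i : Fin n) (σ : ℕ → CTm), (∀ x, CTm.WFC g ar (σ x)) →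
          ∃ k ≤ l, stepsN Tm.Cbv k
            (appList PAT
              (((α i).map fun p => CTm.encode g (Pat.inst σ p)) ++ List.ofFn V))
            (appList (V i)
              ((seqVars (α i)).map fun x => CTm.encode g (σ x)))) ∧
        (∀ Xs : List Tm, Xs.length = m →
          (∀ X ∈ Xs, X = errTm g ∨ ∃ t, CTm.WFC g ar t ∧ X = CTm.encode g t) →
          (errTm g ∈ Xs ∨
            ∀ i, ¬ ∃ ts : List CTm, Xs = ts.map (CTm.encode g) ∧
              MatchesSeq (α i) ts) →
          ∃ k ≤ l, stepsN Tm.Cbv k (appList PAT (Xs ++ List.ofFn V))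
            (errTm g)) := by
  obtain ⟨F, lF, hF, hFr⟩ := exists_first_match_code hlen hwf hlin (List.finRange n)
  obtain ⟨M, lM, -, hMr⟩ := exists_check_code (g := g) (ar := ar) hF (List.range' 0 m)
    (by simp only [List.mem_range'_1]; omega)
  refine ⟨close (fun _ => errTm g) (lams (List.range' 0 (m + n)) M), m + n + (lM + lF),
    fun V hV => ?_⟩
  have main : ∀ Xs : List Tm, Xs.length = m →
      (∀ X ∈ Xs, X = errTm g ∨ ∃ t, CTm.WFC g ar t ∧ X = CTm.encode g t) →
      ∃ ρ : ℕ → Tm, (∀ x, Closed (ρ x)) ∧ (List.range' 0 m).map ρ = Xs ∧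
        (∀ i : Fin n, ρ (m + i) = V i) ∧
        Red (m + n) (appList (close (fun _ => errTm g) (lams (List.range' 0 (m + n)) M))
          (Xs ++ List.ofFn V)) (close ρ M) := by
    intro Xs hX hXs
    have hvals : ∀ W ∈ Xs ++ List.ofFn V, Closed W ∧ IsValue W := by
      intro W hW
      simp only [List.mem_append, List.mem_ofFn] at hW
      rcases hW with hW | ⟨i, rfl⟩
      · obtain rfl | ⟨t, ht, rfl⟩ := hXs W hW
        · exact ⟨closed_errTm g, isValue_errTm g⟩
        · exact ⟨ht.closed_encode, CTm.isValue_encode g t⟩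
      · exact (hV i).symm
    have hl : (Xs ++ List.ofFn V).length = m + n := by simp [hX]
    refine ⟨overwrite (fun _ => errTm g) 0 (Xs ++ List.ofFn V),
      closed_overwrite (fun _ => closed_errTm g) 0 fun W hW => (hvals W hW).1, ?_, ?_, ?_⟩
    · have := map_overwrite_range' (fun _ => errTm g) 0 (Xs ++ List.ofFn V)
      rw [hl, ← List.range'_append_1, List.map_append] at this
      exact (List.append_inj this (by simp [hX])).1
    · intro i
      have := overwrite_add (fun _ => errTm g) 0 (Vs := Xs ++ List.ofFn V) (i := m + i)
        (by rw [hl]; omega)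
      rw [Nat.zero_add] at this
      rw [this, List.getElem_append_right (by omega)]
      simp [hX]
    · have := red_appList_lams (fun _ => closed_errTm g) 0 M _ hvals
      rwa [hl] at this
  have checked : ∀ (ρ : ℕ → Tm), (∀ x, Closed (ρ x)) → ∀ ts : List CTm,
      (∀ t ∈ ts, CTm.WFC g ar t) → (List.range' 0 m).map ρ = ts.map (CTm.encode g) →
      Red lM (close ρ M) (close ρ F) := by
    intro ρ hρ ts hts hx
    have henc : ∀ x ∈ List.range' 0 m, ∃ t, CTm.WFC g ar t ∧ ρ x = CTm.encode g t := by
      intro x hxm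
      have : ρ x ∈ ts.map (CTm.encode g) := hx ▸ List.mem_map_of_mem hxm
      obtain ⟨t, ht, he⟩ := List.mem_map.1 this
      exact ⟨t, hts t ht, he.symm⟩
    exact (hMr ρ hρ fun x hxm => Or.inr (henc x hxm)).2 henc
  constructor
  · intro i σ hσ
    have hts : ∀ t ∈ (α i).map (Pat.inst σ), CTm.WFC g ar t := by
      intro t ht
      obtain ⟨p, hp, rfl⟩ := List.mem_map.1 ht
      exact (hwf i p hp).wfc_inst hσ
    obtain ⟨ρ, hρ, hx, hv, hred⟩ := main ((α i).map fun p => CTm.encode g (Pat.inst σ p))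
      (by simp [hlen]) (by
        intro X hX
        obtain ⟨p, hp, rfl⟩ := List.mem_map.1 hX
        exact Or.inr ⟨_, (hwf i p hp).wfc_inst hσ, rfl⟩)
    have hx' : (List.range' 0 m).map ρ = ((α i).map (Pat.inst σ)).map (CTm.encode g) := by
      rw [hx, List.map_map]
      rfl
    have hmatch := (hFr ρ hρ _ hts hx').1 i (List.mem_finRange i) σ rfl
      fun j hj => hno _ hts i j ⟨σ, rfl⟩ hj
    rw [hv] at hmatch
    exact hred.trans ((checked ρ hρ _ hts hx').trans hmatch)
  · intro Xs hX hXs hfail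
    obtain ⟨ρ, hρ, hx, -, hred⟩ := main Xs hX hXs
    by_cases he : errTm g ∈ Xs
    · have := (hMr ρ hρ fun x hxm => hXs _ (hx ▸ List.mem_map_of_mem hxm)).1 (hx ▸ he)
      exact (hred.trans this).mono (by omega)
    · have henc : ∀ X ∈ Xs, ∃ t, CTm.WFC g ar t ∧ CTm.encode g t = X := fun X hXm =>
        ((hXs X hXm).resolve_left fun h => he (h ▸ hXm)).imp fun t ht => ⟨ht.1, ht.2.symm⟩
      obtain ⟨ts, hts, hxt⟩ : ∃ ts : List CTm, (∀ t ∈ ts, CTm.WFC g ar t) ∧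
          ts.map (CTm.encode g) = Xs := by
        clear hX hXs hfail hx hred he
        induction Xs with
        | nil => exact ⟨[], by simp, rfl⟩
        | cons X Xs ih =>
          simp only [List.mem_cons, forall_eq_or_imp] at henc
          obtain ⟨⟨t, ht, rfl⟩, hrest⟩ := henc
          obtain ⟨ts, hts, rfl⟩ := ih hrest
          exact ⟨t :: ts, by simpa using ⟨ht, hts⟩, rfl⟩
      have hx' := hx.trans hxt.symm
      refine hred.trans ((checked ρ hρ ts hts hx').trans ((hFr ρ hρ ts hts hx').2 ?_))
      intro i _ hm
      exact hfail.resolve_left he i ⟨ts, hxt.symm, hm⟩
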